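/- Let k be a positive integer and let s be a real number with s > k + 1/2. Then ∫_{−∞}^{∞} (t+i)^{2k}·(t²+1)^{−s} dt = (−1)^k · 2^{2+2k−2s} · π · Γ(2s−2k−1) / (Γ(s−2k)·Γ(s)), where on the right-hand side 1/(Γ(s−2k)Γ(s)) is understood via the reciprocal Gamma function (in particular, if s−2k is a nonpositive integer both sides vanish). -/

import Mathlib

open scoped Real BigOperators
open MeasureTheory


lemma base_integrable (σ : ℝ) (h : 1 / 2 < σ) :
    Integrable (fun t : ℝ => (t ^ 2 + 1 : ℝ) ^ (-σ)) := by
  have := integrable_rpow_neg_one_add_norm_sq (E := ℝ) (μ := volume) (r := 2 * σ) (by simp; linarith)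
  refine this.congr (Filter.Eventually.of_forall fun t => ?_)
  simp only [Real.norm_eq_abs, sq_abs]
  rw [add_comm]; congr 1; ring

lemma norm_f (j : ℕ) (σ t : ℝ) :
    ‖((t : ℂ) + Complex.I) ^ j * (((t ^ 2 + 1 : ℝ) ^ (-σ) : ℝ) : ℂ)‖ =
      (t ^ 2 + 1 : ℝ) ^ ((j : ℝ) / 2 - σ) := by
  have hp : 0 < t ^ 2 + 1 := by positivity
  have h1 : ‖(t : ℂ) + Complex.I‖ = (t ^ 2 + 1 : ℝ) ^ (1 / 2 : ℝ) := by
    have := Complex.norm_add_mul_I t 1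
    simp only [Complex.ofReal_one, one_mul, one_pow] at this
    rw [this, Real.sqrt_eq_rpow]
  rw [norm_mul, norm_pow, h1, Complex.norm_real, Real.norm_of_nonneg (by positivity),
    ← Real.rpow_natCast, ← Real.rpow_mul hp.le, ← Real.rpow_add hp]
  congr 1; ring

lemma cont_f (j : ℕ) (σ : ℝ) :
    Continuous (fun t : ℝ => ((t : ℂ) + Complex.I) ^ j * (((t ^ 2 + 1 : ℝ) ^ (-σ) : ℝ) : ℂ)) := by
  have : Continuous (fun t : ℝ => (t ^ 2 + 1 : ℝ) ^ (-σ)) :=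
    Continuous.rpow_const (by fun_prop) (fun t => Or.inl (by positivity))
  fun_prop

lemma integrable_f (j : ℕ) (σ : ℝ) (h : 1 / 2 < σ) :
    Integrable (fun t : ℝ => ((t : ℂ) + Complex.I) ^ (2 * j) *
      (((t ^ 2 + 1 : ℝ) ^ (-(σ + j)) : ℝ) : ℂ)) := by
  refine (base_integrable σ h).mono' (cont_f _ _).aestronglyMeasurable
    (Filter.Eventually.of_forall fun t => ?_)
  rw [norm_f]
  apply le_of_eq; congr 1; push_cast; ring

lemma tendsto_F (j : ℕ) (σ : ℝ) (h : 1 / 2 < σ) (l : Filter ℝ)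
    (hl : Filter.Tendsto (fun t : ℝ => t ^ 2) l Filter.atTop) :
    Filter.Tendsto (fun t : ℝ => ((t : ℂ) + Complex.I) ^ (2 * j + 1) *
      (((t ^ 2 + 1 : ℝ) ^ (-(σ + j)) : ℝ) : ℂ)) l (nhds 0) := by
  rw [tendsto_zero_iff_norm_tendsto_zero]
  have := (tendsto_rpow_neg_atTop (y := σ - 1/2) (by linarith)).comp
    (Filter.tendsto_atTop_add_const_right l 1 hl)
  refine this.congr fun t => ?_
  rw [norm_f]
  simp only [Function.comp]
  congr 1; push_cast; ring

lemma deriv_F (j : ℕ) (σ t : ℝ) :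
    HasDerivAt (fun t : ℝ => ((t : ℂ) + Complex.I) ^ (2 * j + 1) *
      (((t ^ 2 + 1 : ℝ) ^ (-(σ + j)) : ℝ) : ℂ))
      (((j + 1 - σ : ℝ) : ℂ) * (((t : ℂ) + Complex.I) ^ (2 * j) *
        (((t ^ 2 + 1 : ℝ) ^ (-(σ + j)) : ℝ) : ℂ)) -
       ((σ + j : ℝ) : ℂ) * (((t : ℂ) + Complex.I) ^ (2 * (j + 1)) *
        (((t ^ 2 + 1 : ℝ) ^ (-(σ + (j + 1 : ℕ))) : ℝ) : ℂ))) t := by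
  have hp : 0 < t ^ 2 + 1 := by positivity
  have h1 : HasDerivAt (fun t : ℝ => (t ^ 2 + 1 : ℝ) ^ (-(σ + j))) _ t :=
    (((hasDerivAt_id t).pow 2).add_const 1).rpow_const (p := -(σ + j)) (Or.inl hp.ne')
  have h2 : HasDerivAt (fun t : ℝ => ((t : ℂ) + Complex.I) ^ (2 * j + 1)) _ t :=
    ((hasDerivAt_id t).ofReal_comp.add_const Complex.I).pow (2 * j + 1)
  refine (h2.mul h1.ofReal_comp).congr_deriv ?_
  have e : (t ^ 2 + 1 : ℝ) ^ (-(σ + j)) = (t ^ 2 + 1) * (t ^ 2 + 1 : ℝ) ^ (-(σ + (j + 1 : ℕ))) := by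
    rw [mul_comm, ← Real.rpow_add_one hp.ne']; congr 1; push_cast; ring
  have e2 : (-(σ + j) - 1 : ℝ) = -(σ + (j + 1 : ℕ)) := by push_cast; ring
  simp only [e2, e, id, Pi.pow_apply, Complex.ofReal_mul]
  generalize (t ^ 2 + 1 : ℝ) ^ (-(σ + (j + 1 : ℕ))) = X
  have hq : ((t : ℂ) ^ 2 + 1) = (t + Complex.I) * (t - Complex.I) := by
    linear_combination Complex.I_sq
  push_cast
  rw [hq]
  ring

lemma step (j : ℕ) (σ : ℝ) (h : 1 / 2 < σ) :
    ((σ + j : ℝ) : ℂ) * (∫ t : ℝ, ((t : ℂ) + Complex.I) ^ (2 * (j + 1)) *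
        (((t ^ 2 + 1 : ℝ) ^ (-(σ + (j + 1 : ℕ))) : ℝ) : ℂ)) =
    ((j + 1 - σ : ℝ) : ℂ) * (∫ t : ℝ, ((t : ℂ) + Complex.I) ^ (2 * j) *
        (((t ^ 2 + 1 : ℝ) ^ (-(σ + j)) : ℝ) : ℂ)) := by
  have i1 := (integrable_f j σ h).const_mul ((j + 1 - σ : ℝ) : ℂ)
  have i2 := (integrable_f (j + 1) σ h).const_mul ((σ + j : ℝ) : ℂ)
  have := integral_of_hasDerivAt_of_tendsto (deriv_F j σ) (i1.sub i2)
    (tendsto_F j σ h Filter.atBot (by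
      simpa [Function.comp_def, sq_abs] using (Filter.tendsto_pow_atTop (α := ℝ) (n := 2) (by norm_num)).comp
        Filter.tendsto_abs_atBot_atTop))
    (tendsto_F j σ h Filter.atTop (Filter.tendsto_pow_atTop (by norm_num)))
  rw [integral_sub i1 i2, integral_const_mul, integral_const_mul, sub_zero, sub_eq_zero] at this
  exact this.symm

lemma base (σ : ℝ) (h : 1 / 2 < σ) :
    ∫ t : ℝ, (t ^ 2 + 1 : ℝ) ^ (-σ) = √π * Real.Gamma (σ - 1 / 2) / Real.Gamma σ := by
  have hσ : 0 < σ := by linarith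
  have hG := Real.Gamma_pos_of_pos hσ
  rw [eq_div_iff hG.ne', ← integral_mul_const]
  have key : ∀ x ∈ Set.Ioi (0:ℝ), (∫ t : ℝ, x ^ (σ - 1) * Real.exp (-((t ^ 2 + 1) * x)))
      = √π * (Real.exp (-x) * x ^ (σ - 1 / 2 - 1)) := by
    intro x hx
    have hx : 0 < x := hx
    have : ∀ t : ℝ, x ^ (σ - 1) * Real.exp (-((t ^ 2 + 1) * x)) =
        (x ^ (σ - 1) * Real.exp (-x)) * Real.exp (-x * t ^ 2) := by
      intro t
      rw [mul_assoc, ← Real.exp_add]; congr 2; ring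
    simp_rw [this]
    rw [integral_const_mul, integral_gaussian, Real.sqrt_div Real.pi_pos.le,
      show σ - 1 / 2 - 1 = (σ - 1) - 1 / 2 by ring, Real.rpow_sub hx (σ - 1) (1 / 2), ← Real.sqrt_eq_rpow]
    ring
  have e1 : ∀ t : ℝ, (t ^ 2 + 1 : ℝ) ^ (-σ) * Real.Gamma σ =
      ∫ x in Set.Ioi (0:ℝ), x ^ (σ - 1) * Real.exp (-((t ^ 2 + 1) * x)) := by
    intro t
    have hp : 0 < t ^ 2 + 1 := by positivity
    rw [Real.integral_rpow_mul_exp_neg_mul_Ioi hσ hp, one_div, Real.inv_rpow hp.le,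
      Real.rpow_neg hp.le]
  simp_rw [e1]
  have hmeas : Measurable (fun p : ℝ × ℝ => p.2 ^ (σ - 1) * Real.exp (-((p.1 ^ 2 + 1) * p.2))) := by
    fun_prop
  rw [integral_integral_swap]
  · rw [setIntegral_congr_fun measurableSet_Ioi key, integral_const_mul,
      Real.Gamma_eq_integral (by linarith)]
  · refine (integrable_prod_iff' hmeas.aestronglyMeasurable).2 ?_
    constructor
    · refine (ae_restrict_iff' measurableSet_Ioi).2 (Filter.Eventually.of_forall fun x hx => ?_)
      have hx : 0 < x := hx
      refine ((integrable_exp_neg_mul_sq hx).const_mul (x ^ (σ - 1) * Real.exp (-x))).congr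
        (Filter.Eventually.of_forall fun t => ?_)
      simp only [Function.uncurry]
      rw [mul_assoc, ← Real.exp_add]; congr 2; ring
    · have := (Real.GammaIntegral_convergent (s := σ - 1 / 2) (by linarith)).const_mul (√π)
      refine IntegrableOn.congr_fun this (fun x hx => ?_) measurableSet_Ioi
      rw [← key x hx]
      refine integral_congr_ae (Filter.Eventually.of_forall fun t => ?_)
      have hx : 0 < x := hx
      simp only [Function.uncurry]
      rw [Real.norm_of_nonneg (by positivity)]

lemma inv_Gamma_rec (x : ℝ) : (Real.Gamma x)⁻¹ = x * (Real.Gamma (x + 1))⁻¹ := by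
  rcases eq_or_ne x 0 with rfl | hx
  · simp
  · rw [Real.Gamma_add_one hx, mul_inv, ← mul_assoc, mul_inv_cancel₀ hx, one_mul]

lemma general (j : ℕ) (σ : ℝ) (h : 1 / 2 < σ) :
    (∫ t : ℝ, ((t : ℂ) + Complex.I) ^ (2 * j) * (((t ^ 2 + 1 : ℝ) ^ (-(σ + j)) : ℝ) : ℂ)) =
    (((-1) ^ j * (√π * Real.Gamma (σ - 1 / 2) * Real.Gamma σ) *
      ((Real.Gamma (σ - j))⁻¹ * (Real.Gamma (σ + j))⁻¹) : ℝ) : ℂ) := by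
  induction j with
  | zero =>
    have hG := (Real.Gamma_pos_of_pos (show 0 < σ by linarith)).ne'
    simp only [mul_zero, pow_zero, one_mul, Nat.cast_zero, add_zero, sub_zero]
    rw [integral_complex_ofReal, base σ h]
    congr 1
    field_simp
  | succ j ih =>
    have hp : 0 < σ + j := by positivity
    have hs := step j σ h
    rw [ih] at hs
    have hne : ((σ + j : ℝ) : ℂ) ≠ 0 := by exact_mod_cast hp.ne'
    apply mul_left_cancel₀ hne
    rw [hs, ← Complex.ofReal_mul, ← Complex.ofReal_mul]
    congr 1
    have r1 := inv_Gamma_rec (σ - (j + 1 : ℕ))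
    have r2 := inv_Gamma_rec (σ + j)
    rw [show σ - (j + 1 : ℕ) + 1 = σ - j by push_cast; ring] at r1
    rw [r1, r2, show σ + (j + 1 : ℕ) = σ + j + 1 by push_cast; ring]
    push_cast
    ring

theorem integral_eval (k : ℕ) (hk : 1 ≤ k) (s : ℝ) (hs : (k : ℝ) + 1 / 2 < s) :
    (∫ t : ℝ, ((t : ℂ) + Complex.I) ^ (2 * k) * (((t ^ 2 + 1 : ℝ) ^ (-s) : ℝ) : ℂ))
      = (-1 : ℂ) ^ k * (((2 : ℝ) ^ (2 + 2 * (k : ℝ) - 2 * s) : ℝ) : ℂ) * (Real.pi : ℂ) *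
        ((Real.Gamma (2 * s - 2 * (k : ℝ) - 1) /
          (Real.Gamma (s - 2 * (k : ℝ)) * Real.Gamma s) : ℝ) : ℂ) := by
  have g := general k (s - k) (by linarith)
  rw [sub_add_cancel] at g
  rw [g]
  have d := Real.Gamma_mul_Gamma_add_half (s - k - 1 / 2)
  rw [sub_add_cancel, show 2 * (s - k - 1 / 2) = 2 * s - 2 * (k : ℝ) - 1 by ring,
    show 1 - (2 * s - 2 * (k : ℝ) - 1) = 2 + 2 * (k : ℝ) - 2 * s by ring] at d
  rw [mul_assoc (√π), d, show s - k - k = s - 2 * (k : ℝ) by ring, div_eq_mul_inv, mul_inv]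
  have hpi : √π * √π = π := Real.mul_self_sqrt Real.pi_pos.le
  have : ((-1 : ℂ) ^ k) = (((-1) ^ k : ℝ) : ℂ) := by push_cast; rfl
  rw [this, ← Complex.ofReal_mul, ← Complex.ofReal_mul, ← Complex.ofReal_mul]
  congr 1
  linear_combination ((-1) ^ k * 2 ^ (2 + 2 * (k : ℝ) - 2 * s) * (Real.Gamma (2 * s - 2 * (k : ℝ) - 1)) *
    ((Real.Gamma (s - 2 * (k : ℝ)))⁻¹ * (Real.Gamma s)⁻¹)) * hpi
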